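/- Let μ be a Radon measure on ℝⁿ (a Borel measure finite on compact sets), let 1 ≤ p < ∞, and let f ∈ L¹_loc(ℝⁿ,μ). For Q ∈ 𝒟 set a(f)_Q = ℓ(Q)^{γ/p} (1/μ(Q)) ∫_Q f dμ when μ(Q) > 0 and a(f)_Q = 0 otherwise. Suppose either (a) γ < 0, or (b) γ > d > 0 and there are constants c₁, c₂ > 0 with c₁ ℓ(Q)^d ≤ μ(Q) ≤ c₂ ℓ(Q)^d for all Q ∈ 𝒟. Then there is a constant C (depending on n, p, γ, and in case (b) also on d, c₁, c₂) such that sup_{λ>0} λᵖ ∑_{Q∈𝒟 : |a(f)_Q| > λ} ℓ(Q)^{−γ} μ(Q) ≤ C · ∫_{ℝⁿ} |f|ᵖ dμ. -/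

import Mathlib

open MeasureTheory Set
open scoped ENNReal Classical

noncomputable section

/-- The half-open dyadic cube in `ℝⁿ` of generation `k` (sidelength `2 ^ k`) and
corner index `j`, i.e. `∏ᵢ [jᵢ 2ᵏ, (jᵢ+1) 2ᵏ)`. -/
def dyadicCube (n : ℕ) (k : ℤ) (j : Fin n → ℤ) : Set (Fin n → ℝ) :=
  Set.univ.pi fun i => Set.Ico ((j i : ℝ) * 2 ^ k) (((j i : ℝ) + 1) * 2 ^ k)

theorem mem_dyadicCube_iff {n : ℕ} {k : ℤ} {j : Fin n → ℤ} {x : Fin n → ℝ} :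
    x ∈ dyadicCube n k j ↔ ∀ i, ⌊x i / 2 ^ k⌋ = j i := by
  have h2 : (0 : ℝ) < 2 ^ k := by positivity
  simp only [dyadicCube, mem_univ_pi, mem_Ico, Int.floor_eq_iff, le_div_iff₀ h2, div_lt_iff₀ h2]

theorem floor_div_two_zpow_eq_of_le {a b : ℝ} {k m : ℤ} (hkm : k ≤ m)
    (h : ⌊a / 2 ^ k⌋ = ⌊b / 2 ^ k⌋) : ⌊a / 2 ^ m⌋ = ⌊b / 2 ^ m⌋ := by
  obtain ⟨i, rfl⟩ := Int.le.dest hkm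
  have key : ∀ c : ℝ, ⌊c / 2 ^ (k + (i : ℤ))⌋ = ⌊c / 2 ^ k⌋ / ((2 ^ i : ℕ) : ℤ) := by
    intro c
    rw [← Int.floor_div_natCast, div_div, zpow_add₀ two_ne_zero]
    simp
  rw [key, key, h]

theorem dyadicCube_nonempty (n : ℕ) (k : ℤ) (j : Fin n → ℤ) : (dyadicCube n k j).Nonempty := by
  refine ⟨fun i => (j i : ℝ) * 2 ^ k, mem_dyadicCube_iff.2 fun i => ?_⟩
  have h2 : (2 : ℝ) ^ k ≠ 0 := by positivity
  simp [h2]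

theorem measurableSet_dyadicCube (n : ℕ) (k : ℤ) (j : Fin n → ℤ) :
    MeasurableSet (dyadicCube n k j) :=
  MeasurableSet.univ_pi fun _ => measurableSet_Ico

theorem measure_dyadicCube_lt_top {n : ℕ} (μ : Measure (Fin n → ℝ)) [IsFiniteMeasureOnCompacts μ]
    (k : ℤ) (j : Fin n → ℤ) : μ (dyadicCube n k j) < ∞ := by
  refine lt_of_le_of_lt (measure_mono (pi_mono fun i _ => Ico_subset_Icc_self)) ?_
  exact (isCompact_univ_pi fun i => isCompact_Icc).measure_lt_top

/-- The order on (indices of) dyadic cubes given by generation and inclusion. -/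
def DyadicLE {n : ℕ} (Q P : ℤ × (Fin n → ℤ)) : Prop :=
  Q.1 ≤ P.1 ∧ dyadicCube n Q.1 Q.2 ⊆ dyadicCube n P.1 P.2

theorem DyadicLE.refl {n : ℕ} (Q : ℤ × (Fin n → ℤ)) : DyadicLE Q Q := ⟨le_rfl, subset_rfl⟩

theorem DyadicLE.trans {n : ℕ} {Q P R : ℤ × (Fin n → ℤ)} (h : DyadicLE Q P) (h' : DyadicLE P R) :
    DyadicLE Q R := ⟨h.1.trans h'.1, h.2.trans h'.2⟩

theorem DyadicLE.of_mem {n : ℕ} {Q P : ℤ × (Fin n → ℤ)} (h : Q.1 ≤ P.1) {x : Fin n → ℝ}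
    (hQ : x ∈ dyadicCube n Q.1 Q.2) (hP : x ∈ dyadicCube n P.1 P.2) : DyadicLE Q P := by
  refine ⟨h, fun y hy => ?_⟩
  rw [mem_dyadicCube_iff] at *
  intro i
  rw [← hP i]
  exact floor_div_two_zpow_eq_of_le h ((hy i).trans (hQ i).symm)

theorem DyadicLE.eq_of_fst_eq {n : ℕ} {Q P : ℤ × (Fin n → ℤ)} (h : DyadicLE Q P)
    (hl : Q.1 = P.1) : Q = P := by
  obtain ⟨x, hx⟩ := dyadicCube_nonempty n Q.1 Q.2
  have hx' := h.2 hx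
  rw [mem_dyadicCube_iff] at hx hx'
  refine Prod.ext hl (funext fun i => ?_)
  rw [← hx i, ← hx' i, hl]

theorem DyadicLE.total_of_mem {n : ℕ} {Q P : ℤ × (Fin n → ℤ)} {x : Fin n → ℝ}
    (hQ : x ∈ dyadicCube n Q.1 Q.2) (hP : x ∈ dyadicCube n P.1 P.2) :
    DyadicLE Q P ∨ DyadicLE P Q :=
  (le_total Q.1 P.1).imp (fun h => .of_mem h hQ hP) (fun h => .of_mem h hP hQ)

theorem tsum_two_zpow_rpow_of_le {a : ℝ} (ha : a < 0) (k₀ : ℤ) :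
    ∑' k : ℤ, (if k₀ ≤ k then ENNReal.ofReal (((2 : ℝ) ^ k) ^ a) else 0) =
      ENNReal.ofReal (1 - 2 ^ a)⁻¹ * ENNReal.ofReal (((2 : ℝ) ^ k₀) ^ a) := by
  have hr : (2 : ℝ) ^ a < 1 := Real.rpow_lt_one_of_one_lt_of_neg one_lt_two ha
  have hinj : Function.Injective fun i : ℕ => k₀ + (i : ℤ) := fun i j h => by simpa using h
  rw [← hinj.tsum_eq]
  · have : ∀ i : ℕ, (if k₀ ≤ k₀ + (i : ℤ) then ENNReal.ofReal (((2 : ℝ) ^ (k₀ + (i : ℤ))) ^ a)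
        else 0) = ENNReal.ofReal (2 ^ a) ^ i * ENNReal.ofReal (((2 : ℝ) ^ k₀) ^ a) := by
      intro i
      rw [if_pos (by omega), ← ENNReal.ofReal_pow (by positivity),
        ← ENNReal.ofReal_mul (by positivity), zpow_add₀ two_ne_zero,
        Real.mul_rpow (by positivity) (by positivity), mul_comm, zpow_natCast,
        ← Real.rpow_natCast, ← Real.rpow_natCast, ← Real.rpow_mul (by positivity),
        ← Real.rpow_mul (by positivity), mul_comm a]
    simp only [this]
    rw [ENNReal.tsum_mul_right, ENNReal.tsum_geometric, ENNReal.ofReal_inv_of_pos (by linarith),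
      ENNReal.ofReal_sub _ (by positivity), ENNReal.ofReal_one]
  · intro k hk
    have : k₀ ≤ k := by
      by_contra h
      simp [h] at hk
    exact ⟨(k - k₀).toNat, by simp [this]⟩

/-- A selection principle: if every element of a family `B` of dyadic cubes lies `R`-below an
`R`-maximal element of `B`, then weights that are summable `R`-below each cube are controlled by
the mass of the union of the (disjoint) maximal cubes. -/
theorem mul_tsum_le_of_selection {n : ℕ} (μ : Measure (Fin n → ℝ)) (g : (Fin n → ℝ) → ℝ≥0∞)
    (R : ℤ × (Fin n → ℤ) → ℤ × (Fin n → ℤ) → Prop)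
    (hR : ∀ Q P x, x ∈ dyadicCube n Q.1 Q.2 → x ∈ dyadicCube n P.1 P.2 → R Q P ∨ R P Q)
    (w : ℤ × (Fin n → ℤ) → ℝ≥0∞) (B : Set (ℤ × (Fin n → ℤ))) (L C : ℝ≥0∞)
    (hmax : ∀ Q ∈ B, ∃ P ∈ B, R Q P ∧ ∀ P' ∈ B, R P P' → P' = P)
    (hsum : ∀ P, ∑' Q, (if R Q P then w Q else 0) ≤ C * w P)
    (hB : ∀ P ∈ B, L * w P ≤ ∫⁻ x in dyadicCube n P.1 P.2, g x ∂μ) :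
    L * ∑' Q, (if Q ∈ B then w Q else 0) ≤ C * ∫⁻ x, g x ∂μ := by
  set M : Set (ℤ × (Fin n → ℤ)) := {P | P ∈ B ∧ ∀ P' ∈ B, R P P' → P' = P} with hM
  have hdisj : M.PairwiseDisjoint fun P => dyadicCube n P.1 P.2 := by
    intro P hP P' hP' hne
    refine Set.disjoint_left.2 fun x hx hx' => hne ?_
    rcases hR P P' x hx hx' with h | h
    · exact (hP.2 P' hP'.1 h).symm
    · exact hP'.2 P hP.1 h
  calc L * ∑' Q, (if Q ∈ B then w Q else 0)
      ≤ L * ∑' Q, ∑' P : M, (if R Q P then w Q else 0) := by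
        gcongr with Q
        split_ifs with hQ
        · obtain ⟨P, hPB, hQP, hP⟩ := hmax Q hQ
          refine le_trans ?_ (ENNReal.le_tsum (⟨P, hPB, hP⟩ : M))
          simp [hQP]
        · exact zero_le
    _ = L * ∑' P : M, ∑' Q, (if R Q P then w Q else 0) := by rw [ENNReal.tsum_comm]
    _ ≤ L * ∑' P : M, C * w P := by gcongr with P; exact hsum P
    _ = C * ∑' P : M, L * w P := by
        rw [ENNReal.tsum_mul_left, ENNReal.tsum_mul_left]; ring
    _ ≤ C * ∑' P : M, ∫⁻ x in dyadicCube n P.1.1 P.1.2, g x ∂μ := by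
        gcongr with P; exact hB P P.2.1
    _ = C * ∫⁻ x in ⋃ P ∈ M, dyadicCube n P.1 P.2, g x ∂μ := by
        rw [lintegral_biUnion M.to_countable (fun P _ => measurableSet_dyadicCube n P.1 P.2) hdisj]
    _ ≤ C * ∫⁻ x, g x ∂μ := by gcongr; exact Measure.restrict_le_self

theorem exists_dyadicLE_maximal {n : ℕ} {B : Set (ℤ × (Fin n → ℤ))} {Q : ℤ × (Fin n → ℤ)}
    (hQ : Q ∈ B) (hbdd : ∃ N : ℤ, ∀ P ∈ B, DyadicLE Q P → P.1 ≤ N) :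
    ∃ P ∈ B, DyadicLE Q P ∧ ∀ P' ∈ B, DyadicLE P P' → P' = P := by
  obtain ⟨N, hN⟩ := hbdd
  obtain ⟨m, ⟨P, hPB, hQP, rfl⟩, hm⟩ := Int.exists_greatest_of_bdd
    (P := fun m => ∃ P ∈ B, DyadicLE Q P ∧ P.1 = m)
    ⟨N, by rintro _ ⟨P, hPB, hQP, rfl⟩; exact hN P hPB hQP⟩ ⟨Q.1, Q, hQ, .refl Q, rfl⟩
  exact ⟨P, hPB, hQP, fun P' hP' h =>
    (h.eq_of_fst_eq (le_antisymm h.1 (hm _ ⟨P', hP', hQP.trans h, rfl⟩))).symm⟩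

theorem exists_dyadicLE_minimal {n : ℕ} {B : Set (ℤ × (Fin n → ℤ))} {Q : ℤ × (Fin n → ℤ)}
    (hQ : Q ∈ B) (hbdd : ∃ N : ℤ, ∀ P ∈ B, DyadicLE P Q → N ≤ P.1) :
    ∃ P ∈ B, DyadicLE P Q ∧ ∀ P' ∈ B, DyadicLE P' P → P' = P := by
  obtain ⟨N, hN⟩ := hbdd
  obtain ⟨m, ⟨P, hPB, hQP, rfl⟩, hm⟩ := Int.exists_least_of_bdd
    (P := fun m => ∃ P ∈ B, DyadicLE P Q ∧ P.1 = m)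
    ⟨N, by rintro _ ⟨P, hPB, hQP, rfl⟩; exact hN P hPB hQP⟩ ⟨Q.1, Q, hQ, .refl Q, rfl⟩
  exact ⟨P, hPB, hQP, fun P' hP' h =>
    h.eq_of_fst_eq (le_antisymm h.1 (hm _ ⟨P', hP', h.trans hQP, rfl⟩))⟩

theorem ofReal_abs_integral_rpow_le {α : Type*} [MeasurableSpace α] {ν : Measure α}
    [IsProbabilityMeasure ν] {f : α → ℝ} (hf : AEStronglyMeasurable f ν) {p : ℝ} (hp : 1 ≤ p) :
    ENNReal.ofReal (|∫ x, f x ∂ν| ^ p) ≤ ∫⁻ x, ENNReal.ofReal (|f x| ^ p) ∂ν := by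
  have hp0 : 0 < p := by linarith
  have h1 := eLpNorm'_le_eLpNorm'_of_exponent_le zero_lt_one hp ν hf
  simp only [eLpNorm', ENNReal.rpow_one, div_one] at h1
  have h2 := ENNReal.rpow_le_rpow ((enorm_integral_le_lintegral_enorm f).trans h1) hp0.le
  rw [← ENNReal.rpow_mul, one_div_mul_cancel hp0.ne', ENNReal.rpow_one] at h2
  simpa only [Real.enorm_eq_ofReal_abs, ENNReal.ofReal_rpow_of_nonneg (abs_nonneg _) hp0.le]
    using h2

theorem ofReal_mul_le_setLIntegral_of_lt_average {α : Type*} [MeasurableSpace α] {μ : Measure α}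
    {s : Set α} (hs : μ s ≠ ∞) {f : α → ℝ} (hf : AEStronglyMeasurable f μ) {p γ l t : ℝ}
    (hp : 1 ≤ p) (hl : 0 < l) (ht : 0 < t) (h : l < |t ^ (γ / p) * ⨍ x in s, f x ∂μ|) :
    ENNReal.ofReal (l ^ p) * (ENNReal.ofReal (t ^ (-γ)) * μ s) ≤
      ∫⁻ x in s, ENNReal.ofReal (|f x| ^ p) ∂μ := by
  have hp0 : 0 < p := by linarith
  by_cases h0 : μ s = 0
  · simp [h0]
  have : IsFiniteMeasure (μ.restrict s) := ⟨by simpa using hs.lt_top⟩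
  have : NeZero (μ.restrict s) := ⟨by simpa using h0⟩
  have hJ : ENNReal.ofReal (|⨍ x in s, f x ∂μ| ^ p) ≤
      (μ s)⁻¹ * ∫⁻ x in s, ENNReal.ofReal (|f x| ^ p) ∂μ := by
    have := ofReal_abs_integral_rpow_le
      (ν := ((μ.restrict s) univ)⁻¹ • μ.restrict s) (f := f) (hf.restrict.smul_measure _) hp
    simpa [average] using this
  have hlt : l ^ p * t ^ (-γ) ≤ |⨍ x in s, f x ∂μ| ^ p := by
    rw [abs_mul, abs_of_pos (Real.rpow_pos_of_pos ht _)] at h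
    have h1 := Real.rpow_le_rpow hl.le h.le hp0.le
    rw [Real.mul_rpow (by positivity) (abs_nonneg _), ← Real.rpow_mul ht.le,
      div_mul_cancel₀ _ hp0.ne'] at h1
    rwa [Real.rpow_neg ht.le, ← div_eq_mul_inv, div_le_iff₀' (by positivity)]
  rw [← mul_assoc, ← ENNReal.ofReal_mul (by positivity), mul_comm]
  calc μ s * ENNReal.ofReal (l ^ p * t ^ (-γ))
      ≤ μ s * ((μ s)⁻¹ * ∫⁻ x in s, ENNReal.ofReal (|f x| ^ p) ∂μ) := by
        gcongr; exact (ENNReal.ofReal_le_ofReal hlt).trans hJ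
    _ = _ := by rw [← mul_assoc, ENNReal.mul_inv_cancel h0 hs, one_mul]

theorem tsum_dyadicLE_le_of_neg {n : ℕ} (μ : Measure (Fin n → ℝ)) {γ : ℝ} (hγ : γ < 0)
    (P : ℤ × (Fin n → ℤ)) :
    ∑' Q : ℤ × (Fin n → ℤ), (if DyadicLE Q P then
        ENNReal.ofReal (((2 : ℝ) ^ Q.1) ^ (-γ)) * μ (dyadicCube n Q.1 Q.2) else 0) ≤
      ENNReal.ofReal (1 - 2 ^ γ)⁻¹ *
        (ENNReal.ofReal (((2 : ℝ) ^ P.1) ^ (-γ)) * μ (dyadicCube n P.1 P.2)) := by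
  have hlevel : ∀ k : ℤ, ∑' j : Fin n → ℤ, (if DyadicLE (k, j) P then
        ENNReal.ofReal (((2 : ℝ) ^ k) ^ (-γ)) * μ (dyadicCube n k j) else 0) ≤
      (if -P.1 ≤ -k then ENNReal.ofReal (((2 : ℝ) ^ (-k)) ^ γ) else 0) *
        μ (dyadicCube n P.1 P.2) := by
    intro k
    have hpow : ((2 : ℝ) ^ (-k)) ^ γ = ((2 : ℝ) ^ k) ^ (-γ) := by
      rw [zpow_neg, Real.inv_rpow (by positivity), Real.rpow_neg (by positivity)]
    rw [hpow]
    by_cases hk : k ≤ P.1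
    · rw [if_pos (by omega)]
      calc _ = ∑' j : Fin n → ℤ, ENNReal.ofReal (((2 : ℝ) ^ k) ^ (-γ)) *
              μ (if DyadicLE (k, j) P then dyadicCube n k j else ∅) := by
            refine tsum_congr fun j => ?_
            split_ifs <;> simp
        _ ≤ _ := by
            rw [ENNReal.tsum_mul_left]
            gcongr
            refine (tsum_meas_le_meas_iUnion_of_disjoint μ (fun j => ?_) ?_).trans
              (measure_mono (iUnion_subset fun j => ?_))
            · split_ifs
              exacts [measurableSet_dyadicCube n k j, MeasurableSet.empty]
            · intro j j' hne
              refine Set.disjoint_left.2 fun x hx hx' => hne ?_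
              dsimp only at hx hx'
              split_ifs at hx hx' with h1 h2 h2
              · rw [mem_dyadicCube_iff] at hx hx'
                exact funext fun i => (hx i).symm.trans (hx' i)
              all_goals simp_all
            · split_ifs with h
              exacts [h.2, empty_subset _]
    · have : ∀ j, ¬ DyadicLE (k, j) P := fun j h => hk h.1
      simp [this]
  calc _ = ∑' k : ℤ, ∑' j : Fin n → ℤ, (if DyadicLE (k, j) P then
        ENNReal.ofReal (((2 : ℝ) ^ k) ^ (-γ)) * μ (dyadicCube n k j) else 0) :=
        ENNReal.tsum_prod (f := fun k j => if DyadicLE (k, j) P then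
          ENNReal.ofReal (((2 : ℝ) ^ k) ^ (-γ)) * μ (dyadicCube n k j) else 0)
    _ ≤ ∑' k : ℤ, (if -P.1 ≤ -k then ENNReal.ofReal (((2 : ℝ) ^ (-k)) ^ γ) else 0) *
        μ (dyadicCube n P.1 P.2) := ENNReal.tsum_le_tsum hlevel
    _ = _ := by
        have hneg := (Equiv.neg ℤ).tsum_eq
          (fun k : ℤ => if -P.1 ≤ k then ENNReal.ofReal (((2 : ℝ) ^ k) ^ γ) else 0)
        simp only [Equiv.neg_apply] at hneg
        rw [ENNReal.tsum_mul_right, hneg,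
          tsum_two_zpow_rpow_of_le hγ, zpow_neg, Real.inv_rpow (by positivity),
          Real.rpow_neg (by positivity), mul_assoc]

theorem tsum_dyadicLE_le_of_growth {n : ℕ} (μ : Measure (Fin n → ℝ)) {γ d c₁ c₂ : ℝ} (hγ : d < γ)
    (hc₁ : 0 < c₁) (hc₂ : 0 < c₂)
    (hμ : ∀ (k : ℤ) (j : Fin n → ℤ),
      ENNReal.ofReal (c₁ * ((2 : ℝ) ^ k) ^ d) ≤ μ (dyadicCube n k j) ∧
      μ (dyadicCube n k j) ≤ ENNReal.ofReal (c₂ * ((2 : ℝ) ^ k) ^ d))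
    (P : ℤ × (Fin n → ℤ)) :
    ∑' Q : ℤ × (Fin n → ℤ), (if DyadicLE P Q then
        ENNReal.ofReal (((2 : ℝ) ^ Q.1) ^ (-γ)) * μ (dyadicCube n Q.1 Q.2) else 0) ≤
      ENNReal.ofReal (c₂ * (1 - 2 ^ (d - γ))⁻¹ * c₁⁻¹) *
        (ENNReal.ofReal (((2 : ℝ) ^ P.1) ^ (-γ)) * μ (dyadicCube n P.1 P.2)) := by
  have hpow : ∀ (c : ℝ) (k : ℤ), ((2 : ℝ) ^ k) ^ (-γ) * (c * ((2 : ℝ) ^ k) ^ d) =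
      c * ((2 : ℝ) ^ k) ^ (d - γ) := by
    intro c k
    rw [sub_eq_add_neg, Real.rpow_add (by positivity)]; ring
  have hr : (2 : ℝ) ^ (d - γ) < 1 := Real.rpow_lt_one_of_one_lt_of_neg one_lt_two (by linarith)
  have hr' : 0 < (1 - (2 : ℝ) ^ (d - γ))⁻¹ := inv_pos.2 (by linarith)
  obtain ⟨x, hx⟩ := dyadicCube_nonempty n P.1 P.2
  have hlevel : ∀ k : ℤ, ∑' j : Fin n → ℤ, (if DyadicLE P (k, j) then
        ENNReal.ofReal (((2 : ℝ) ^ k) ^ (-γ)) * μ (dyadicCube n k j) else 0) ≤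
      ENNReal.ofReal c₂ *
        (if P.1 ≤ k then ENNReal.ofReal (((2 : ℝ) ^ k) ^ (d - γ)) else 0) := by
    intro k
    rw [tsum_eq_single (fun i => ⌊x i / 2 ^ k⌋)]
    · split_ifs with h1 h2 h2
      · rw [← ENNReal.ofReal_mul hc₂.le, ← hpow, ENNReal.ofReal_mul (by positivity)]
        gcongr
        exact (hμ k _).2
      · exact absurd h1.1 h2
      all_goals simp
    · intro j hj
      refine if_neg fun h => hj (funext fun i => ?_)
      exact (mem_dyadicCube_iff.1 (h.2 hx) i).symm
  calc _ = ∑' k : ℤ, ∑' j : Fin n → ℤ, (if DyadicLE P (k, j) then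
        ENNReal.ofReal (((2 : ℝ) ^ k) ^ (-γ)) * μ (dyadicCube n k j) else 0) :=
        ENNReal.tsum_prod (f := fun k j => if DyadicLE P (k, j) then
          ENNReal.ofReal (((2 : ℝ) ^ k) ^ (-γ)) * μ (dyadicCube n k j) else 0)
    _ ≤ ∑' k : ℤ, ENNReal.ofReal c₂ *
        (if P.1 ≤ k then ENNReal.ofReal (((2 : ℝ) ^ k) ^ (d - γ)) else 0) :=
        ENNReal.tsum_le_tsum hlevel
    _ = ENNReal.ofReal (c₂ * (1 - 2 ^ (d - γ))⁻¹ * c₁⁻¹) *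
        (ENNReal.ofReal (((2 : ℝ) ^ P.1) ^ (-γ)) *
          ENNReal.ofReal (c₁ * ((2 : ℝ) ^ P.1) ^ d)) := by
        rw [ENNReal.tsum_mul_left, tsum_two_zpow_rpow_of_le (by linarith),
          ← ENNReal.ofReal_mul (by positivity), ← ENNReal.ofReal_mul (by positivity),
          ← ENNReal.ofReal_mul (by positivity), ← ENNReal.ofReal_mul (by positivity), hpow]
        congr 1
        field_simp
    _ ≤ _ := by gcongr; exact (hμ P.1 P.2).1

theorem exists_forall_le_of_mul_two_zpow_rpow_le {a : ℝ} (ha : 0 < a) {c I : ℝ≥0∞} (hc : c ≠ 0)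
    (hI : I ≠ ∞) :
    ∃ N : ℤ, ∀ k : ℤ, c * ENNReal.ofReal (((2 : ℝ) ^ k) ^ a) ≤ I → k ≤ N := by
  have hlim : Filter.Tendsto (fun m : ℕ => ENNReal.ofReal (((2 : ℝ) ^ m) ^ a)) Filter.atTop
      (nhds ∞) :=
    ENNReal.tendsto_ofReal_nhds_top.2 ((tendsto_rpow_atTop ha).comp
      (tendsto_pow_atTop_atTop_of_one_lt one_lt_two))
  have hlt : I / c < ∞ := ENNReal.div_lt_top hI hc
  obtain ⟨m, hm⟩ := (hlim.eventually (lt_mem_nhds hlt)).exists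
  refine ⟨m, fun k hk => ?_⟩
  by_contra! hmk
  have h1 : ENNReal.ofReal (((2 : ℝ) ^ k) ^ a) ≤ I / c :=
    ENNReal.le_div_iff_mul_le (.inl hc) (.inr hI) |>.2 (by rwa [mul_comm])
  refine absurd (hm.trans_le ?_) h1.not_gt
  gcongr
  rw [← zpow_natCast]
  exact zpow_le_zpow_right₀ one_le_two hmk.le

theorem measure_ne_zero_of_lt_average {α : Type*} [MeasurableSpace α] {μ : Measure α} {s : Set α}
    {f : α → ℝ} {l t : ℝ} (hl : 0 < l) (h : l < |t * ⨍ x in s, f x ∂μ|) : μ s ≠ 0 := by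
  intro h0
  rw [Measure.restrict_eq_zero.2 h0, average_zero_measure, mul_zero, abs_zero] at h
  exact hl.not_gt h

theorem mul_tsum_le_of_neg {n : ℕ} {μ : Measure (Fin n → ℝ)} {γ : ℝ} (hγ : γ < 0)
    {g : (Fin n → ℝ) → ℝ≥0∞} (hg : ∫⁻ x, g x ∂μ ≠ ∞) {L : ℝ≥0∞} (hL : L ≠ 0)
    {B : Set (ℤ × (Fin n → ℤ))} (hB₀ : ∀ Q ∈ B, μ (dyadicCube n Q.1 Q.2) ≠ 0)
    (hB : ∀ Q ∈ B, L * (ENNReal.ofReal (((2 : ℝ) ^ Q.1) ^ (-γ)) * μ (dyadicCube n Q.1 Q.2)) ≤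
      ∫⁻ x in dyadicCube n Q.1 Q.2, g x ∂μ) :
    L * ∑' Q : ℤ × (Fin n → ℤ), (if Q ∈ B then
        ENNReal.ofReal (((2 : ℝ) ^ Q.1) ^ (-γ)) * μ (dyadicCube n Q.1 Q.2) else 0) ≤
      ENNReal.ofReal (1 - 2 ^ γ)⁻¹ * ∫⁻ x, g x ∂μ := by
  refine mul_tsum_le_of_selection μ g DyadicLE (fun _ _ _ => DyadicLE.total_of_mem) _ B L _
    (fun Q hQ => exists_dyadicLE_maximal hQ ?_) (tsum_dyadicLE_le_of_neg μ hγ) hB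
  obtain ⟨N, hN⟩ := exists_forall_le_of_mul_two_zpow_rpow_le (neg_pos.2 hγ)
    (mul_ne_zero hL (hB₀ Q hQ)) hg
  refine ⟨N, fun P hP hQP => hN P.1 ?_⟩
  calc L * μ (dyadicCube n Q.1 Q.2) * ENNReal.ofReal (((2 : ℝ) ^ P.1) ^ (-γ))
      ≤ L * (ENNReal.ofReal (((2 : ℝ) ^ P.1) ^ (-γ)) * μ (dyadicCube n P.1 P.2)) := by
        rw [mul_assoc, mul_comm (μ _)]
        gcongr
        exact hQP.2
    _ ≤ ∫⁻ x in dyadicCube n P.1 P.2, g x ∂μ := hB P hP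
    _ ≤ ∫⁻ x, g x ∂μ := setLIntegral_le_lintegral _ _

theorem mul_tsum_le_of_growth {n : ℕ} {μ : Measure (Fin n → ℝ)} {γ d c₁ c₂ : ℝ} (hγ : d < γ)
    (hc₁ : 0 < c₁) (hc₂ : 0 < c₂)
    (hμ : ∀ (k : ℤ) (j : Fin n → ℤ),
      ENNReal.ofReal (c₁ * ((2 : ℝ) ^ k) ^ d) ≤ μ (dyadicCube n k j) ∧
      μ (dyadicCube n k j) ≤ ENNReal.ofReal (c₂ * ((2 : ℝ) ^ k) ^ d))
    {g : (Fin n → ℝ) → ℝ≥0∞} (hg : ∫⁻ x, g x ∂μ ≠ ∞) {L : ℝ≥0∞} (hL : L ≠ 0)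
    {B : Set (ℤ × (Fin n → ℤ))}
    (hB : ∀ Q ∈ B, L * (ENNReal.ofReal (((2 : ℝ) ^ Q.1) ^ (-γ)) * μ (dyadicCube n Q.1 Q.2)) ≤
      ∫⁻ x in dyadicCube n Q.1 Q.2, g x ∂μ) :
    L * ∑' Q : ℤ × (Fin n → ℤ), (if Q ∈ B then
        ENNReal.ofReal (((2 : ℝ) ^ Q.1) ^ (-γ)) * μ (dyadicCube n Q.1 Q.2) else 0) ≤
      ENNReal.ofReal (c₂ * (1 - 2 ^ (d - γ))⁻¹ * c₁⁻¹) * ∫⁻ x, g x ∂μ := by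
  refine mul_tsum_le_of_selection μ g (fun Q P => DyadicLE P Q)
    (fun _ _ _ hQ hP => (DyadicLE.total_of_mem hQ hP).symm) _ B L _
    (fun Q hQ => exists_dyadicLE_minimal hQ ?_) (tsum_dyadicLE_le_of_growth μ hγ hc₁ hc₂ hμ) hB
  obtain ⟨N, hN⟩ := exists_forall_le_of_mul_two_zpow_rpow_le (sub_pos.2 hγ)
    (mul_ne_zero hL (ENNReal.ofReal_pos.2 hc₁).ne') hg
  refine ⟨-N, fun P hP _ => neg_le.1 (hN (-P.1) ?_)⟩
  have hpow : c₁ * ((2 : ℝ) ^ (-P.1)) ^ (γ - d) =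
      ((2 : ℝ) ^ P.1) ^ (-γ) * (c₁ * ((2 : ℝ) ^ P.1) ^ d) := by
    rw [zpow_neg, Real.inv_rpow (by positivity), ← Real.rpow_neg (by positivity), neg_sub,
      sub_eq_add_neg, Real.rpow_add (by positivity)]
    ring
  calc L * ENNReal.ofReal c₁ * ENNReal.ofReal (((2 : ℝ) ^ (-P.1)) ^ (γ - d))
      = L * (ENNReal.ofReal (((2 : ℝ) ^ P.1) ^ (-γ)) *
          ENNReal.ofReal (c₁ * ((2 : ℝ) ^ P.1) ^ d)) := by
        rw [mul_assoc, ← ENNReal.ofReal_mul hc₁.le, ← ENNReal.ofReal_mul (by positivity), hpow]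
    _ ≤ L * (ENNReal.ofReal (((2 : ℝ) ^ P.1) ^ (-γ)) * μ (dyadicCube n P.1 P.2)) := by
        gcongr
        exact (hμ P.1 P.2).1
    _ ≤ ∫⁻ x in dyadicCube n P.1 P.2, g x ∂μ := hB P hP
    _ ≤ ∫⁻ x, g x ∂μ := setLIntegral_le_lintegral _ _

/-- for a Radon measure `μ`, `1 ≤ p < ∞`, and `f ∈ L¹_loc(μ)`, with
`a(f)_Q = ℓ(Q)^{γ/p} ⨍_Q f dμ` (which is `0` when `μ(Q) = 0`), if either `γ < 0`, or
`γ > d > 0` and `c₁ ℓ(Q)^d ≤ μ(Q) ≤ c₂ ℓ(Q)^d` on dyadic cubes, then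
`sup_{λ>0} λ^p ∑_{|a(f)_Q|>λ} ℓ(Q)^{-γ} μ(Q) ≤ C ∫ |f|^p dμ`. -/
theorem statement8 (n : ℕ) (p γ d c₁ c₂ : ℝ) (hp : 1 ≤ p) :
    ∃ C : ℝ, 0 < C ∧
      ∀ (μ : Measure (Fin n → ℝ)), IsFiniteMeasureOnCompacts μ →
      (γ < 0 ∨
        (0 < d ∧ d < γ ∧ 0 < c₁ ∧ 0 < c₂ ∧
          ∀ (k : ℤ) (j : Fin n → ℤ),
            ENNReal.ofReal (c₁ * ((2 : ℝ) ^ k) ^ d) ≤ μ (dyadicCube n k j) ∧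
            μ (dyadicCube n k j) ≤ ENNReal.ofReal (c₂ * ((2 : ℝ) ^ k) ^ d))) →
      ∀ f : (Fin n → ℝ) → ℝ, LocallyIntegrable f μ →
      (⨆ l ∈ Set.Ioi (0 : ℝ), ENNReal.ofReal (l ^ p) *
          ∑' Q : ℤ × (Fin n → ℤ),
            if l < |((2 : ℝ) ^ Q.1) ^ (γ / p) * ⨍ x in dyadicCube n Q.1 Q.2, f x ∂μ| then
              ENNReal.ofReal (((2 : ℝ) ^ Q.1) ^ (-γ)) * μ (dyadicCube n Q.1 Q.2) else 0)
        ≤ ENNReal.ofReal C * ∫⁻ x, ENNReal.ofReal (|f x| ^ p) ∂μ := by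
  refine ⟨max 1 (max (1 - 2 ^ γ)⁻¹ (c₂ * (1 - 2 ^ (d - γ))⁻¹ * c₁⁻¹)), by positivity, ?_⟩
  intro μ _ hcase f hf
  refine iSup₂_le fun l (hl : 0 < l) => ?_
  by_cases hI : ∫⁻ x, ENNReal.ofReal (|f x| ^ p) ∂μ = ∞
  · rw [hI, ENNReal.mul_top (by simp)]
    exact le_top
  have hL : ENNReal.ofReal (l ^ p) ≠ 0 := (ENNReal.ofReal_pos.2 (by positivity)).ne'
  set B : Set (ℤ × (Fin n → ℤ)) :=
    {Q | l < |((2 : ℝ) ^ Q.1) ^ (γ / p) * ⨍ x in dyadicCube n Q.1 Q.2, f x ∂μ|} with hBdef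
  have hB : ∀ Q ∈ B, ENNReal.ofReal (l ^ p) *
      (ENNReal.ofReal (((2 : ℝ) ^ Q.1) ^ (-γ)) * μ (dyadicCube n Q.1 Q.2)) ≤
      ∫⁻ x in dyadicCube n Q.1 Q.2, ENNReal.ofReal (|f x| ^ p) ∂μ := fun Q hQ =>
    ofReal_mul_le_setLIntegral_of_lt_average (measure_dyadicCube_lt_top μ Q.1 Q.2).ne
      hf.aestronglyMeasurable hp hl (by positivity) hQ
  calc _ = ENNReal.ofReal (l ^ p) * ∑' Q : ℤ × (Fin n → ℤ), (if Q ∈ B then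
        ENNReal.ofReal (((2 : ℝ) ^ Q.1) ^ (-γ)) * μ (dyadicCube n Q.1 Q.2) else 0) := by
        simp only [hBdef, mem_ofPred_eq]
    _ ≤ _ := by
        rcases hcase with hγ | ⟨-, hγ, hc₁, hc₂, hμ⟩
        · refine (mul_tsum_le_of_neg hγ hI hL
            (fun Q hQ => measure_ne_zero_of_lt_average hl hQ) hB).trans ?_
          gcongr
          exact (le_max_left _ _).trans (le_max_right _ _)
        · refine (mul_tsum_le_of_growth hγ hc₁ hc₂ hμ hI hL hB).trans ?_
          gcongr
          exact (le_max_right _ _).trans (le_max_right _ _)
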